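/- arXiv:2412.14130 — 2 statements merged into one kernel-verified Lean document; each statement's English description precedes it below -/
import Mathlib

section
/- Let 0 < α < 1 and define g(z) = exp(-((1+z)/(1-z))^α) for z ∈ 𝔻. Then for every n ≥ 0, the n-th derivative of g can be written as g^{(n)}(z) = g(z) · Σ_{l=1}^{κ(n)} a_{nl} ((1+z)/(1-z))^{γ_{nl}} (1-z)^{η_{nl}} for finitely many real constants a_{nl}, γ_{nl}, η_{nl}, and consequently g^{(n)}(r) → 0 as r → 1⁻ along (0,1). -/
open Metric

/-- The Cayley transform `(1+z)/(1-z)` maps the unit disc to the right half-plane. -/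
lemma re_cayley_pos {z : ℂ} (hz : z ∈ ball (0 : ℂ) 1) : 0 < ((1 + z) / (1 - z)).re := by
  have hz' : ‖z‖ < 1 := by simpa using hz
  have hsq : z.re * z.re + z.im * z.im < 1 := by
    rw [← Complex.normSq_apply, Complex.normSq_eq_norm_sq]
    nlinarith [norm_nonneg z]
  have hne : 1 - z ≠ 0 := by
    intro h
    rw [← sub_eq_zero.mp h] at hz'
    simp at hz'
  have hpos : 0 < Complex.normSq (1 - z) := Complex.normSq_pos.mpr hne
  rw [Complex.div_re, ← add_div]
  refine div_pos ?_ hpos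
  simp only [Complex.add_re, Complex.sub_re, Complex.add_im, Complex.sub_im, Complex.one_re,
    Complex.one_im]
  nlinarith

lemma re_one_sub_pos {z : ℂ} (hz : z ∈ ball (0 : ℂ) 1) : 0 < (1 - z).re := by
  have hz' : ‖z‖ < 1 := by simpa using hz
  have := Complex.re_le_norm z
  simp only [Complex.sub_re, Complex.one_re]
  linarith

/-- The function `exp(-((1+z)/(1-z))^α)`. -/
noncomputable def expOuter (α : ℝ) (z : ℂ) : ℂ :=
  Complex.exp (-(((1 + z) / (1 - z)) ^ (α : ℂ)))

/-- The function `((1+z)/(1-z))^γ (1-z)^η`, indexed by the pair `(γ, η)`. -/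
noncomputable def cayleyMonomial (p : ℝ × ℝ) (z : ℂ) : ℂ :=
  ((1 + z) / (1 - z)) ^ (p.1 : ℂ) * (1 - z) ^ (p.2 : ℂ)

/-- The real span of the functions `((1+z)/(1-z))^γ (1-z)^η`. -/
noncomputable def cayleySpan : Submodule ℝ (ℂ → ℂ) :=
  Submodule.span ℝ (Set.range cayleyMonomial)

lemma cayleyMonomial_mem (p : ℝ × ℝ) : cayleyMonomial p ∈ cayleySpan :=
  Submodule.subset_span ⟨p, rfl⟩

lemma hasDerivAt_cayley_cpow (γ : ℝ) {z : ℂ} (hz : z ∈ ball (0 : ℂ) 1) :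
    HasDerivAt (fun ζ : ℂ => ((1 + ζ) / (1 - ζ)) ^ (γ : ℂ))
      (2 * γ * cayleyMonomial (γ - 1, -2) z) z := by
  have hu := re_one_sub_pos hz
  have hne : 1 - z ≠ 0 := fun h => by simp [h] at hu
  have hw : HasDerivAt (fun ζ : ℂ => (1 + ζ) / (1 - ζ)) (2 / (1 - z) ^ 2) z := by
    refine HasDerivAt.congr_deriv (((hasDerivAt_id z).const_add 1).div
      ((hasDerivAt_id z).const_sub 1) hne) ?_
    simp only [id]
    ring
  refine HasDerivAt.congr_deriv (hw.cpow_const (c := (γ : ℂ)) (Or.inl (re_cayley_pos hz))) ?_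
  have h2 : (1 - z) ^ (-2 : ℂ) = ((1 - z) ^ 2)⁻¹ := by
    rw [Complex.cpow_neg, Complex.cpow_ofNat]
  simp only [cayleyMonomial]
  push_cast
  rw [h2]
  ring

lemma hasDerivAt_cayleyMonomial (γ η : ℝ) {z : ℂ} (hz : z ∈ ball (0 : ℂ) 1) :
    HasDerivAt (cayleyMonomial (γ, η))
      (2 * γ * cayleyMonomial (γ - 1, η - 2) z - η * cayleyMonomial (γ, η - 1) z) z := by
  have hu := re_one_sub_pos hz
  have hne : 1 - z ≠ 0 := fun h => by simp [h] at hu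
  have hd := ((hasDerivAt_id z).const_sub 1).cpow_const (c := (η : ℂ)) (Or.inl hu)
  refine HasDerivAt.congr_deriv ((hasDerivAt_cayley_cpow γ hz).mul hd) ?_
  have h2 : (1 - z) ^ ((η : ℂ) - 2) = (1 - z) ^ (-2 : ℂ) * (1 - z) ^ (η : ℂ) := by
    rw [← Complex.cpow_add _ _ hne]
    ring_nf
  simp only [cayleyMonomial, id]
  push_cast
  rw [h2]
  ring

lemma hasDerivAt_expOuter (α : ℝ) {z : ℂ} (hz : z ∈ ball (0 : ℂ) 1) :
    HasDerivAt (expOuter α) (expOuter α z * (-(2 * α) * cayleyMonomial (α - 1, -2) z)) z := by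
  refine HasDerivAt.congr_deriv ((hasDerivAt_cayley_cpow α hz).neg.cexp) ?_
  simp only [expOuter, Pi.neg_apply]
  ring

lemma cayleyMonomial_mul (p q : ℝ × ℝ) {z : ℂ} (hz : z ∈ ball (0 : ℂ) 1) :
    cayleyMonomial p z * cayleyMonomial q z = cayleyMonomial (p + q) z := by
  have hu := re_one_sub_pos hz
  have hw := re_cayley_pos hz
  have hu0 : 1 - z ≠ 0 := fun h => by simp [h] at hu
  have hw0 : (1 + z) / (1 - z) ≠ 0 := fun h => by simp [h] at hw
  simp only [cayleyMonomial, Prod.fst_add, Prod.snd_add, Complex.ofReal_add,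
    Complex.cpow_add _ _ hu0, Complex.cpow_add _ _ hw0]
  ring

/-- Multiples of `expOuter α` by elements of `cayleySpan` are stable under differentiation. -/
lemma exists_hasDerivAt_expOuter_mul (α : ℝ) {h : ℂ → ℂ} (hh : h ∈ cayleySpan) :
    ∃ k ∈ cayleySpan, ∀ z ∈ ball (0 : ℂ) 1,
      HasDerivAt (fun ζ => expOuter α ζ * h ζ) (expOuter α z * k z) z := by
  induction hh using Submodule.span_induction with
  | mem x hx =>
    obtain ⟨⟨γ, η⟩, rfl⟩ := hx
    refine ⟨(-(2 * α)) • cayleyMonomial ((α - 1, -2) + (γ, η)) +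
      ((2 * γ) • cayleyMonomial (γ - 1, η - 2) - η • cayleyMonomial (γ, η - 1)),
      add_mem (Submodule.smul_mem _ _ (cayleyMonomial_mem _))
        (sub_mem (Submodule.smul_mem _ _ (cayleyMonomial_mem _))
          (Submodule.smul_mem _ _ (cayleyMonomial_mem _))), fun z hz => ?_⟩
    refine HasDerivAt.congr_deriv ((hasDerivAt_expOuter α hz).mul
      (hasDerivAt_cayleyMonomial γ η hz)) ?_
    simp only [Pi.add_apply, Pi.sub_apply, Pi.smul_apply, Complex.real_smul,
      ← cayleyMonomial_mul _ _ hz]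
    push_cast
    ring
  | zero => exact ⟨0, zero_mem _, fun z _ => by simpa using hasDerivAt_const z (0 : ℂ)⟩
  | add x y _ _ hx hy =>
    obtain ⟨k, hk, hkd⟩ := hx
    obtain ⟨l, hl, hld⟩ := hy
    refine ⟨k + l, add_mem hk hl, fun z hz => ?_⟩
    simpa only [Pi.add_apply, mul_add] using (hkd z hz).fun_add (hld z hz)
  | smul c x _ hx =>
    obtain ⟨k, hk, hkd⟩ := hx
    refine ⟨c • k, Submodule.smul_mem _ _ hk, fun z hz => ?_⟩
    simpa only [Pi.smul_apply, mul_smul_comm] using (hkd z hz).fun_const_smul c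

lemma exists_iteratedDeriv_expOuter (α : ℝ) (n : ℕ) :
    ∃ h ∈ cayleySpan, ∀ z ∈ ball (0 : ℂ) 1,
      iteratedDeriv n (expOuter α) z = expOuter α z * h z := by
  induction n with
  | zero =>
    exact ⟨cayleyMonomial (0, 0), cayleyMonomial_mem _, fun z _ => by simp [cayleyMonomial]⟩
  | succ n ih =>
    obtain ⟨h, hh, heq⟩ := ih
    obtain ⟨k, hk, hkd⟩ := exists_hasDerivAt_expOuter_mul α hh
    refine ⟨k, hk, fun z hz => ?_⟩
    rw [iteratedDeriv_succ, ← (hkd z hz).deriv]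
    exact Filter.EventuallyEq.deriv_eq
      (Filter.eventually_of_mem (isOpen_ball.mem_nhds hz) heq)

lemma ofReal_mem_ball_of_mem_Ioo {r : ℝ} (hr : r ∈ Set.Ioo (0 : ℝ) 1) :
    (r : ℂ) ∈ ball (0 : ℂ) 1 := by
  simpa [abs_of_pos hr.1] using hr.2

lemma tendsto_cayley_atTop :
    Filter.Tendsto (fun r : ℝ => (1 + r) / (1 - r)) (nhdsWithin 1 (Set.Ioo 0 1))
      Filter.atTop := by
  have h1 : Filter.Tendsto (fun r : ℝ => 1 + r) (nhdsWithin 1 (Set.Ioo 0 1)) (nhds (1 + 1)) :=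
    ((continuous_const.add continuous_id).tendsto (1 : ℝ)).mono_left nhdsWithin_le_nhds
  have h2 : Filter.Tendsto (fun r : ℝ => 1 - r) (nhdsWithin 1 (Set.Ioo 0 1))
      (nhdsWithin 0 (Set.Ioi 0)) := by
    refine tendsto_nhdsWithin_iff.mpr ⟨?_, ?_⟩
    · simpa using ((continuous_const.sub continuous_id).tendsto (1 : ℝ)).mono_left
        (nhdsWithin_le_nhds (s := Set.Ioo (0 : ℝ) 1)) (f := fun r : ℝ => 1 - r)
    · filter_upwards [self_mem_nhdsWithin] with r hr
      exact sub_pos.mpr hr.2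
  simpa only [div_eq_mul_inv, Function.comp_def] using
    h1.pos_mul_atTop (by norm_num) (tendsto_inv_nhdsGT_zero.comp h2)

lemma tendsto_rpow_mul_exp_neg_rpow {α : ℝ} (hα : 0 < α) (β : ℝ) :
    Filter.Tendsto (fun t : ℝ => t ^ β * Real.exp (-t ^ α)) Filter.atTop (nhds 0) := by
  refine ((tendsto_rpow_mul_exp_neg_mul_atTop_nhds_zero (β / α) 1 one_pos).comp
    (tendsto_rpow_atTop hα)).congr' ?_
  filter_upwards [Filter.eventually_ge_atTop 0] with t ht
  simp only [Function.comp_apply, ← Real.rpow_mul ht, mul_div_cancel₀ _ hα.ne', neg_mul, one_mul]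

lemma tendsto_expOuter_mul_cayleyMonomial {α : ℝ} (hα : 0 < α) (p : ℝ × ℝ) :
    Filter.Tendsto (fun r : ℝ => expOuter α r * cayleyMonomial p r)
      (nhdsWithin 1 (Set.Ioo 0 1)) (nhds 0) := by
  obtain ⟨γ, η⟩ := p
  have h1 : Filter.Tendsto (fun r : ℝ => (1 + r) ^ η) (nhdsWithin 1 (Set.Ioo 0 1))
      (nhds ((1 + 1) ^ η)) :=
    (((continuous_const.add continuous_id).tendsto (1 : ℝ)).mono_left
      nhdsWithin_le_nhds).rpow_const (Or.inl (by norm_num))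
  have h2 := ((tendsto_rpow_mul_exp_neg_rpow hα (γ - η)).comp tendsto_cayley_atTop).mul h1
  rw [zero_mul] at h2
  have h3 := (Complex.continuous_ofReal.tendsto 0).comp h2
  rw [Complex.ofReal_zero] at h3
  refine h3.congr' ?_
  filter_upwards [self_mem_nhdsWithin] with r hr
  have hu : 0 < 1 - r := sub_pos.mpr hr.2
  have hv : 0 < 1 + r := by linarith [hr.1]
  have hw : 0 < (1 + r) / (1 - r) := div_pos hv hu
  have hη : (1 - r) ^ η = (1 + r) ^ η * ((1 + r) / (1 - r)) ^ (-η) := by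
    rw [Real.rpow_neg hw.le, Real.div_rpow hv.le hu.le, inv_div,
      mul_div_cancel₀ _ (Real.rpow_pos_of_pos hv η).ne']
  have hwc : (1 + (r : ℂ)) / (1 - r) = ((1 + r) / (1 - r) : ℝ) := by push_cast; rfl
  have huc : 1 - (r : ℂ) = (1 - r : ℝ) := by push_cast; rfl
  simp only [Function.comp_apply, expOuter, cayleyMonomial, hwc]
  rw [huc, ← Complex.ofReal_cpow hw.le, ← Complex.ofReal_cpow hw.le, ← Complex.ofReal_cpow hu.le,
    ← Complex.ofReal_neg, ← Complex.ofReal_exp, ← Complex.ofReal_mul, ← Complex.ofReal_mul, hη,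
    sub_eq_add_neg γ, Real.rpow_add hw]
  congr 1
  ring

lemma tendsto_expOuter_mul {α : ℝ} (hα : 0 < α) {h : ℂ → ℂ} (hh : h ∈ cayleySpan) :
    Filter.Tendsto (fun r : ℝ => expOuter α r * h r)
      (nhdsWithin 1 (Set.Ioo 0 1)) (nhds 0) := by
  induction hh using Submodule.span_induction with
  | mem x hx =>
    obtain ⟨p, rfl⟩ := hx
    exact tendsto_expOuter_mul_cayleyMonomial hα p
  | zero => simp
  | add x y _ _ hx hy => simpa only [Pi.add_apply, mul_add, add_zero] using hx.add hy
  | smul c x _ hx =>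
    simpa only [Pi.smul_apply, mul_smul_comm, smul_zero] using hx.const_smul c

/-- For `0 < α < 1` and `g(z) = exp(-((1+z)/(1-z))^α)` (principal branch), every derivative
`g^{(n)}` has the form `g · Σ_l a_l ((1+z)/(1-z))^{γ_l} (1-z)^{η_l}` with finitely many real
constants, and consequently `g^{(n)}(r) → 0` as `r → 1⁻` along `(0,1)`. -/
theorem deriv_decay_of_exp_outer (α : ℝ) (hα0 : 0 < α) (hα1 : α < 1) :
    ∀ n : ℕ,
      (∃ (κ : ℕ) (a γ η : Fin κ → ℝ), ∀ z ∈ ball (0 : ℂ) 1,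
        iteratedDeriv n (fun ζ : ℂ => Complex.exp (-(((1 + ζ) / (1 - ζ)) ^ (α : ℂ)))) z =
          Complex.exp (-(((1 + z) / (1 - z)) ^ (α : ℂ))) *
            ∑ l : Fin κ, ((a l : ℝ) : ℂ) * ((1 + z) / (1 - z)) ^ ((γ l : ℝ) : ℂ) *
              (1 - z) ^ ((η l : ℝ) : ℂ)) ∧
      Filter.Tendsto
        (fun r : ℝ =>
          iteratedDeriv n (fun ζ : ℂ => Complex.exp (-(((1 + ζ) / (1 - ζ)) ^ (α : ℂ)))) (r : ℂ))
        (nhdsWithin 1 (Set.Ioo 0 1)) (nhds 0) := by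
  intro n
  obtain ⟨h, hh, heq⟩ := exists_iteratedDeriv_expOuter α n
  refine ⟨?_, ?_⟩
  · obtain ⟨κ, a, m, rfl⟩ := Submodule.mem_span_set'.mp hh
    choose p hp using fun i => (m i).2
    refine ⟨κ, a, fun i => (p i).1, fun i => (p i).2, fun z hz => (heq z hz).trans ?_⟩
    simp only [expOuter, Finset.sum_apply, Pi.smul_apply, Complex.real_smul, ← hp,
      cayleyMonomial, mul_assoc]
  · refine (tendsto_expOuter_mul hα0 hh).congr' ?_
    filter_upwards [self_mem_nhdsWithin] with r hr
    exact (heq r (ofReal_mem_ball_of_mem_Ioo hr)).symm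
end

section
/- Suppose C > 0, Λ ⊂ (0,1) is finite, k_λ ≥ 1 are integers, B = ∏_{λ∈Λ} b_λ^{k_λ}, and φ, g ∈ H^∞ satisfy φ(λ) ≠ 0 for every λ ∈ Λ and g^{(k)}(r) → 0 as r → 1⁻ for every k ≥ 0. Then there exists r₀ ∈ (0,1) such that for every w ∈ [r₀, 1) there exists f ∈ H^∞ with g ∘ β_w - f·φ ∈ B·H^∞ and dist(f, B·H^∞) ≤ C. -/
open Metric

/-- The Möbius map `β_w(z) = (w - z)/(1 - conj(w) z)`. -/
noncomputable def mobius (w z : ℂ) : ℂ := (w - z) / (1 - (starRingEnd ℂ) w * z)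

/-- The Blaschke factor `b_μ(z) = (|μ|/μ)(μ - z)/(1 - conj(μ)z)`, with `b_0(z) = z`. -/
noncomputable def blaschke (μ : ℂ) : ℂ → ℂ := fun z =>
  if μ = 0 then z else ((‖μ‖ : ℂ) / μ) * (μ - z) / (1 - (starRingEnd ℂ) μ * z)

/-- A function belongs to `H^∞`: it is analytic and bounded on the unit disk. -/
def MemHinf (f : ℂ → ℂ) : Prop :=
  AnalyticOn ℂ f (ball (0 : ℂ) 1) ∧ ∃ C : ℝ, ∀ z ∈ ball (0 : ℂ) 1, ‖f z‖ ≤ C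

open Filter Topology

theorem memHinf_iff {f : ℂ → ℂ} : MemHinf f ↔
    DifferentiableOn ℂ f (ball 0 1) ∧ ∃ M : ℝ, ∀ z ∈ ball (0 : ℂ) 1, ‖f z‖ ≤ M :=
  and_congr_left fun _ =>
    ⟨fun h => h.differentiableOn, fun h => (h.analyticOnNhd isOpen_ball).analyticOn⟩

namespace MemHinf

theorem const (c : ℂ) : MemHinf fun _ => c :=
  memHinf_iff.2 ⟨differentiableOn_const c, ‖c‖, fun _ _ => le_rfl⟩

theorem add {f g : ℂ → ℂ} (hf : MemHinf f) (hg : MemHinf g) :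
    MemHinf fun z => f z + g z := by
  rw [memHinf_iff] at *
  obtain ⟨hf, M, hM⟩ := hf
  obtain ⟨hg, N, hN⟩ := hg
  exact ⟨hf.add hg, M + N, fun z hz =>
    (norm_add_le _ _).trans (add_le_add (hM z hz) (hN z hz))⟩

theorem mul {f g : ℂ → ℂ} (hf : MemHinf f) (hg : MemHinf g) :
    MemHinf fun z => f z * g z := by
  rw [memHinf_iff] at *
  obtain ⟨hf, M, hM⟩ := hf
  obtain ⟨hg, N, hN⟩ := hg
  refine ⟨hf.mul hg, M * N, fun z hz => ?_⟩
  rw [norm_mul]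
  exact mul_le_mul (hM z hz) (hN z hz) (norm_nonneg _) ((norm_nonneg _).trans (hM z hz))

end MemHinf

section Mobius

variable {w : ℝ} {z : ℂ}

theorem one_sub_mul_ne_zero_of_mem_ball (hw : w ∈ Set.Ioo (0 : ℝ) 1) (hz : z ∈ ball (0 : ℂ) 1) :
    1 - (w : ℂ) * z ≠ 0 := by
  intro h
  have h1 : ‖(w : ℂ) * z‖ = 1 := by rw [← sub_eq_zero.1 h, norm_one]
  rw [norm_mul, Complex.norm_real, Real.norm_of_nonneg hw.1.le] at h1
  have hz' := mem_ball_zero_iff.1 hz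
  nlinarith [hw.1, hw.2, norm_nonneg z]

theorem mobius_ofReal (w : ℝ) (z : ℂ) : mobius w z = (w - z) / (1 - w * z) := by
  simp [mobius]

theorem norm_mobius_lt_one (hw : w ∈ Set.Ioo (0 : ℝ) 1) (hz : z ∈ ball (0 : ℂ) 1) :
    ‖mobius w z‖ < 1 := by
  have h0 := one_sub_mul_ne_zero_of_mem_ball hw hz
  rw [mobius_ofReal, norm_div, div_lt_one (norm_pos_iff.2 h0)]
  refine lt_of_pow_lt_pow_left₀ 2 (norm_nonneg _) ?_
  have hz' := mem_ball_zero_iff.1 hz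
  have hz2 : z.re * z.re + z.im * z.im < 1 := by
    rw [← Complex.normSq_apply, Complex.normSq_eq_norm_sq]
    nlinarith [norm_nonneg z]
  rw [← Complex.normSq_eq_norm_sq, ← Complex.normSq_eq_norm_sq, Complex.normSq_apply,
    Complex.normSq_apply]
  simp
  have hw2 : w * w < 1 := by nlinarith [hw.1, hw.2]
  nlinarith [mul_pos (sub_pos.2 hw2) (sub_pos.2 hz2)]

theorem differentiableOn_mobius (hw : w ∈ Set.Ioo (0 : ℝ) 1) :
    DifferentiableOn ℂ (mobius w) (ball 0 1) := by
  have : mobius w = fun z => ((w : ℂ) - z) / (1 - w * z) := funext (mobius_ofReal w)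
  rw [this]
  exact DifferentiableOn.div (by fun_prop) (by fun_prop)
    fun z hz => one_sub_mul_ne_zero_of_mem_ball hw hz

theorem blaschke_eq_mobius (hw : w ∈ Set.Ioo (0 : ℝ) 1) : blaschke w = mobius w := by
  have h : (w : ℂ) ≠ 0 := by exact_mod_cast hw.1.ne'
  funext z
  simp [blaschke, mobius, h, abs_of_pos hw.1]

theorem tendsto_mobius_ofReal {x : ℝ} (hx : x ∈ Set.Ioo (0 : ℝ) 1) :
    Tendsto (fun w : ℝ => (w - x) / (1 - w * x)) (𝓝[<] 1) (𝓝[Set.Ioo 0 1] 1) := by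
  refine tendsto_nhdsWithin_iff.2 ⟨?_, ?_⟩
  · have hc : ContinuousAt (fun w : ℝ => (w - x) / (1 - w * x)) 1 :=
      ContinuousAt.div (by fun_prop) (by fun_prop) (by linarith [hx.2])
    have := hc.tendsto
    rw [one_mul, div_self (by linarith [hx.2])] at this
    exact this.mono_left nhdsWithin_le_nhds
  · filter_upwards [Ioo_mem_nhdsLT hx.2] with w hw
    have hd : 0 < 1 - w * x := by nlinarith [hw.1, hw.2, hx.1, hx.2]
    refine ⟨div_pos (by linarith [hw.1]) hd, (div_lt_one hd).2 ?_⟩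
    nlinarith [mul_pos (sub_pos.2 hw.2) (by linarith [hx.1] : (0 : ℝ) < 1 + x)]

end Mobius

theorem norm_dslope_le_of_bounded {f : ℂ → ℂ} {M : ℝ} {c z : ℂ}
    (hf : DifferentiableOn ℂ f (ball 0 1)) (hM : ∀ z ∈ ball (0 : ℂ) 1, ‖f z‖ ≤ M)
    (hc : c ∈ ball (0 : ℂ) 1) (hz : z ∈ ball (0 : ℂ) 1) :
    ‖dslope f c z‖ ≤ (2 * M + 1) / (1 - ‖c‖) := by
  have hc' : 0 < 1 - ‖c‖ := sub_pos.2 (mem_ball_zero_iff.1 hc)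
  have hd : ∀ y ∈ ball (0 : ℂ) 1, ‖f y - f c‖ < 2 * M + 1 := fun y hy => by
    linarith [norm_sub_le (f y) (f c), hM y hy, hM c hc]
  by_cases h : z ∈ ball c (1 - ‖c‖)
  · have hsub : ball c (1 - ‖c‖) ⊆ ball 0 1 := ball_subset_ball' (by simp)
    exact Complex.norm_dslope_le_div_of_mapsTo_ball (hf.mono hsub)
      (fun y hy => mem_closedBall_iff_norm.2 (hd y (hsub hy)).le) h
  · have hr : 1 - ‖c‖ ≤ ‖z - c‖ := by simpa [mem_ball_iff_norm, dist_eq_norm] using h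
    have hne : z ≠ c := fun hzc => by simp [hzc] at hr; linarith
    rw [dslope_of_ne _ hne, slope_def_module, norm_smul, norm_inv, inv_mul_eq_div]
    exact div_le_div₀ ((norm_nonneg _).trans (hd z hz).le) (hd z hz).le hc' hr

/-- A family of functions that is eventually uniformly bounded and holomorphic on the unit disk,
and tends to zero at every point of the interval `(0,1)`. -/
def IsNullFamily {ι : Type*} (l : Filter ι) (F : ι → ℂ → ℂ) : Prop :=
  (∃ M : ℝ, ∀ᶠ i in l, DifferentiableOn ℂ (F i) (ball 0 1) ∧
    ∀ z ∈ ball (0 : ℂ) 1, ‖F i z‖ ≤ M) ∧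
  ∀ x ∈ Set.Ioo (0 : ℝ) 1, Tendsto (fun i => F i x) l (𝓝 0)

theorem ofReal_mem_ball {x : ℝ} (hx : x ∈ Set.Ioo (0 : ℝ) 1) : (x : ℂ) ∈ ball (0 : ℂ) 1 := by
  simpa [abs_of_pos hx.1] using hx.2

theorem eventually_bounded_dslope {ι : Type*} {l : Filter ι} {F : ι → ℂ → ℂ} {c : ℂ}
    (hc : c ∈ ball (0 : ℂ) 1)
    (h : ∃ M : ℝ, ∀ᶠ i in l, DifferentiableOn ℂ (F i) (ball 0 1) ∧
      ∀ z ∈ ball (0 : ℂ) 1, ‖F i z‖ ≤ M) :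
    ∃ M : ℝ, ∀ᶠ i in l, DifferentiableOn ℂ (dslope (F i) c) (ball 0 1) ∧
      ∀ z ∈ ball (0 : ℂ) 1, ‖dslope (F i) c z‖ ≤ M := by
  obtain ⟨M, hM⟩ := h
  refine ⟨(2 * M + 1) / (1 - ‖c‖), hM.mono fun i hi => ⟨?_, fun z hz => ?_⟩⟩
  · exact (Complex.differentiableOn_dslope (isOpen_ball.mem_nhds hc)).2 hi.1
  · exact norm_dslope_le_of_bounded hi.1 hi.2 hc hz

theorem IsNullFamily.dslope {ι : Type*} {l : Filter ι} {F : ι → ℂ → ℂ} (hF : IsNullFamily l F)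
    {x : ℝ} (hx : x ∈ Set.Ioo (0 : ℝ) 1) : IsNullFamily l fun i => dslope (F i) x := by
  have hxb := ofReal_mem_ball hx
  have hb := eventually_bounded_dslope hxb hF.1
  have hne : ∀ y ∈ Set.Ioo (0 : ℝ) 1, y ≠ x →
      Tendsto (fun i => _root_.dslope (F i) x (y : ℂ)) l (𝓝 0) := by
    intro y hy hyx
    have hyx' : (y : ℂ) ≠ x := by exact_mod_cast hyx
    have := ((hF.2 y hy).sub (hF.2 x hx)).const_mul (((y : ℂ) - x)⁻¹)
    simpa [dslope_of_ne _ hyx', slope_def_module] using this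
  refine ⟨hb, fun y hy => ?_⟩
  rcases ne_or_eq y x with hyx | rfl
  · exact hne y hy hyx
  obtain ⟨N, hN⟩ := eventually_bounded_dslope hxb hb
  rw [Metric.tendsto_nhds]
  intro ε hε
  have hNp : 0 < |N| + 1 := by positivity
  obtain ⟨t, hyt, ht⟩ : ∃ t, y < t ∧ t < min 1 (y + ε / 2 / (|N| + 1)) :=
    exists_between (lt_min hy.2 (lt_add_of_pos_right _ (by positivity)))
  have ht1 : t ∈ Set.Ioo (0 : ℝ) 1 := ⟨hy.1.trans hyt, ht.trans_le (min_le_left _ _)⟩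
  have hts : (t - y) * (|N| + 1) < ε / 2 := by
    rw [← lt_div_iff₀ hNp]
    linarith [ht.trans_le (min_le_right _ _)]
  filter_upwards [hN, Metric.tendsto_nhds.1 (hne t ht1 hyt.ne') (ε / 2) (half_pos hε)]
    with i hi hit
  rw [dist_zero_right] at hit ⊢
  have e := sub_smul_dslope (_root_.dslope (F i) (y : ℂ)) (y : ℂ) (t : ℂ)
  have hn : ‖_root_.dslope (F i) y (t : ℂ) - _root_.dslope (F i) y (y : ℂ)‖
      ≤ (t - y) * (|N| + 1) := by
    rw [← e, norm_smul, ← Complex.ofReal_sub, Complex.norm_real,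
      Real.norm_of_nonneg (sub_pos.2 hyt).le]
    exact mul_le_mul_of_nonneg_left
      (((hi.2 t (ofReal_mem_ball ht1)).trans (le_abs_self N)).trans (by linarith))
      (sub_pos.2 hyt).le
  have := norm_sub_norm_le (_root_.dslope (F i) y (y : ℂ)) (_root_.dslope (F i) y (t : ℂ))
  rw [norm_sub_rev] at this
  linarith

/-- On the disk, `F = F(x) + b_x · mobiusQuotient x F`. -/
noncomputable def mobiusQuotient (x : ℝ) (F : ℂ → ℂ) (z : ℂ) : ℂ :=
  -(1 - x * z) * dslope F x z

theorem eq_add_mobius_mul_mobiusQuotient {x : ℝ} (hx : x ∈ Set.Ioo (0 : ℝ) 1) (F : ℂ → ℂ)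
    {z : ℂ} (hz : z ∈ ball (0 : ℂ) 1) :
    F z = F x + mobius x z * mobiusQuotient x F z := by
  have h0 := one_sub_mul_ne_zero_of_mem_ball hx hz
  have e := sub_smul_dslope F (x : ℂ) z
  rw [smul_eq_mul] at e
  rw [mobius_ofReal, mobiusQuotient]
  field_simp
  linear_combination -e

theorem IsNullFamily.mobiusQuotient {ι : Type*} {l : Filter ι} {F : ι → ℂ → ℂ}
    (hF : IsNullFamily l F) {x : ℝ} (hx : x ∈ Set.Ioo (0 : ℝ) 1) :
    IsNullFamily l fun i => mobiusQuotient x (F i) := by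
  obtain ⟨⟨M, hM⟩, hlim⟩ := hF.dslope hx
  refine ⟨⟨2 * M, hM.mono fun i hi => ⟨?_, fun z hz => ?_⟩⟩, fun y hy => ?_⟩
  · exact DifferentiableOn.mul (by fun_prop) hi.1
  · have hz' := mem_ball_zero_iff.1 hz
    have h1 : ‖-(1 - (x : ℂ) * z)‖ ≤ 2 := by
      rw [norm_neg]
      refine (norm_sub_le _ _).trans ?_
      rw [norm_one, norm_mul, Complex.norm_real, Real.norm_of_nonneg hx.1.le]
      nlinarith [hx.1, hx.2, norm_nonneg z]
    change ‖-(1 - (x : ℂ) * z) * _root_.dslope (F i) x z‖ ≤ _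
    rw [norm_mul]
    exact mul_le_mul h1 (hi.2 z hz) (norm_nonneg _) zero_le_two
  · simpa [_root_.mobiusQuotient] using (hlim y hy).const_mul (-(1 - (x : ℂ) * y))

theorem MemHinf.mobiusQuotient {F : ℂ → ℂ} (hF : MemHinf F) {x : ℝ}
    (hx : x ∈ Set.Ioo (0 : ℝ) 1) : MemHinf (mobiusQuotient x F) := by
  rw [memHinf_iff] at hF
  obtain ⟨hd, M, hM⟩ := hF
  have hxb := ofReal_mem_ball hx
  have h1 : MemHinf fun z => -(1 - (x : ℂ) * z) := by
    refine memHinf_iff.2 ⟨by fun_prop, 1 + |x|, fun z hz => ?_⟩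
    rw [norm_neg]
    refine (norm_sub_le _ _).trans ?_
    rw [norm_one, norm_mul, Complex.norm_real, Real.norm_eq_abs]
    nlinarith [mem_ball_zero_iff.1 hz, norm_nonneg z, abs_nonneg x]
  exact h1.mul (memHinf_iff.2
    ⟨(Complex.differentiableOn_dslope (isOpen_ball.mem_nhds hxb)).2 hd, _,
      fun z hz => norm_dslope_le_of_bounded hd hM hxb hz⟩)

/-- Every null family is, modulo multiples of `B`, uniformly small. -/
def ReducesNullFamilies {ι : Type*} (l : Filter ι) (B : ℂ → ℂ) : Prop :=
  ∀ F : ι → ℂ → ℂ, IsNullFamily l F → ∃ p q : ι → ℂ → ℂ, IsNullFamily l q ∧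
    (∀ᶠ i in l, DifferentiableOn ℂ (p i) (ball 0 1)) ∧
    (∀ ε > 0, ∀ᶠ i in l, ∀ z ∈ ball (0 : ℂ) 1, ‖p i z‖ ≤ ε) ∧
    ∀ i, ∀ z ∈ ball (0 : ℂ) 1, F i z = p i z + B z * q i z

namespace ReducesNullFamilies

variable {ι : Type*} {l : Filter ι}

theorem one : ReducesNullFamilies l 1 := fun F hF =>
  ⟨fun _ _ => 0, F, hF, .of_forall fun _ => differentiableOn_const 0,
    fun ε hε => .of_forall fun _ _ _ => by simpa using hε.le, fun _ _ _ => by simp⟩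

theorem mobius {x : ℝ} (hx : x ∈ Set.Ioo (0 : ℝ) 1) :
    ReducesNullFamilies l (_root_.mobius x) := fun F hF =>
  ⟨fun i _ => F i x, fun i => mobiusQuotient x (F i), hF.mobiusQuotient hx,
    .of_forall fun _ => differentiableOn_const _,
    fun ε hε => ((Metric.tendsto_nhds.1 (hF.2 x hx)) ε hε).mono fun i hi _ _ => by
      simpa using hi.le,
    fun i _ hz => eq_add_mobius_mul_mobiusQuotient hx (F i) hz⟩

theorem mul {A B : ℂ → ℂ} (hA : ReducesNullFamilies l A) (hB : ReducesNullFamilies l B)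
    (hAd : DifferentiableOn ℂ A (ball 0 1)) (hA1 : ∀ z ∈ ball (0 : ℂ) 1, ‖A z‖ ≤ 1) :
    ReducesNullFamilies l (A * B) := by
  intro F hF
  obtain ⟨p, q, hq, hpd, hp, e⟩ := hA F hF
  obtain ⟨p', q', hq', hpd', hp', e'⟩ := hB q hq
  refine ⟨fun i z => p i z + A z * p' i z, q', hq', ?_, fun ε hε => ?_, fun i z hz => ?_⟩
  · filter_upwards [hpd, hpd'] with i h h'
    exact h.add (hAd.mul h')
  · filter_upwards [hp (ε / 2) (half_pos hε), hp' (ε / 2) (half_pos hε)] with i h h' z hz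
    have h2 : ‖A z * p' i z‖ ≤ ε / 2 := by
      rw [norm_mul]
      exact (mul_le_of_le_one_left (norm_nonneg _) (hA1 z hz)).trans (h' z hz)
    linarith [norm_add_le (p i z) (A z * p' i z), h z hz]
  · rw [e i z hz, e' i z hz, Pi.mul_apply]
    ring

end ReducesNullFamilies

/-- `φ` is invertible in `H^∞` modulo multiples of `B`. -/
def InvertibleModulo (φ B : ℂ → ℂ) : Prop :=
  ∃ u v : ℂ → ℂ, MemHinf u ∧ MemHinf v ∧ ∀ z ∈ ball (0 : ℂ) 1, u z * φ z + B z * v z = 1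

namespace InvertibleModulo

variable {φ : ℂ → ℂ}

theorem one : InvertibleModulo φ 1 :=
  ⟨fun _ => 0, fun _ => 1, .const 0, .const 1, fun _ _ => by simp⟩

theorem mobius (hφ : MemHinf φ) {x : ℝ} (hx : x ∈ Set.Ioo (0 : ℝ) 1) (h0 : φ x ≠ 0) :
    InvertibleModulo φ (_root_.mobius x) := by
  refine ⟨fun _ => (φ x)⁻¹, fun z => -(φ x)⁻¹ * mobiusQuotient x φ z, .const _,
    (MemHinf.const _).mul (hφ.mobiusQuotient hx), fun z hz => ?_⟩
  have e := eq_add_mobius_mul_mobiusQuotient hx φ hz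
  have hi := inv_mul_cancel₀ h0
  linear_combination (φ x)⁻¹ * e + hi

theorem mul (hφ : MemHinf φ) {A B : ℂ → ℂ} (hA : InvertibleModulo φ A)
    (hB : InvertibleModulo φ B) : InvertibleModulo φ (A * B) := by
  obtain ⟨u, v, hu, hv, e⟩ := hA
  obtain ⟨u', v', hu', hv', e'⟩ := hB
  refine ⟨fun z => (u z + u' z) + (-1) * (u z * u' z * φ z), fun z => v z * v' z,
    (hu.add hu').add ((MemHinf.const _).mul ((hu.mul hu').mul hφ)), hv.mul hv', fun z hz => ?_⟩
  have h1 := e z hz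
  have h2 := e' z hz
  rw [Pi.mul_apply]
  linear_combination (B z * v' z) * h1 + (1 - u z * φ z) * h2

end InvertibleModulo

theorem isNullFamily_comp_mobius {g : ℂ → ℂ} (hg : MemHinf g)
    (hlim : Tendsto (fun r : ℝ => g r) (𝓝[Set.Ioo 0 1] 1) (𝓝 0)) :
    IsNullFamily (𝓝[<] (1 : ℝ)) fun w z => g (mobius w z) := by
  obtain ⟨hd, M, hM⟩ := memHinf_iff.1 hg
  refine ⟨⟨M, ?_⟩, fun x hx => ?_⟩
  · filter_upwards [Ioo_mem_nhdsLT (zero_lt_one' ℝ)] with w hw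
    have hmaps : Set.MapsTo (mobius w) (ball 0 1) (ball 0 1) := fun z hz =>
      mem_ball_zero_iff.2 (norm_mobius_lt_one hw hz)
    exact ⟨hd.comp (differentiableOn_mobius hw) hmaps, fun z hz => hM _ (hmaps hz)⟩
  · refine (hlim.comp (tendsto_mobius_ofReal hx)).congr fun w => ?_
    simp [mobius_ofReal]

theorem prod_blaschke_pow_induction {P : (ℂ → ℂ) → Prop} {Λ : Finset ℝ}
    (hΛ : ∀ x ∈ Λ, 0 < x ∧ x < 1) (k : ℝ → ℕ) (h1 : P 1)
    (hmul : ∀ A B, P A → P B → P (A * B)) (hm : ∀ x ∈ Λ, P (mobius x)) :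
    P (∏ x ∈ Λ, blaschke (x : ℂ) ^ k x) := by
  refine Finset.prod_induction _ P hmul h1 fun x hx => ?_
  rw [blaschke_eq_mobius (hΛ x hx)]
  induction k x with
  | zero => simpa using h1
  | succ n ih => rw [pow_succ]; exact hmul _ _ ih (hm x hx)

/-- Given `C > 0`, a finite Blaschke product `B` with zeros `Λ ⊂ (0,1)` of multiplicities
`k_λ ≥ 1`, and `φ, g ∈ H^∞` with `φ(λ) ≠ 0` on `Λ` and all derivatives of `g` tending to `0`
radially at `1`, there is `r₀ ∈ (0,1)` such that for every `w ∈ [r₀,1)` some `f ∈ H^∞`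
satisfies `g ∘ β_w - fφ ∈ B·H^∞` and `dist(f, B·H^∞) ≤ C`. -/
theorem interpolation_with_small_distance
    (C : ℝ) (hC : 0 < C)
    (Λ : Finset ℝ) (hΛ : ∀ x ∈ Λ, 0 < x ∧ x < 1)
    (k : ℝ → ℕ) (hk : ∀ x ∈ Λ, 1 ≤ k x)
    (φ g : ℂ → ℂ) (hφ : MemHinf φ) (hg : MemHinf g)
    (hφ0 : ∀ x ∈ Λ, φ (x : ℂ) ≠ 0)
    (hgd : ∀ m : ℕ, Filter.Tendsto (fun r : ℝ => iteratedDeriv m g (r : ℂ))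
      (nhdsWithin 1 (Set.Ioo 0 1)) (nhds 0)) :
    ∃ r₀ ∈ Set.Ioo (0 : ℝ) 1, ∀ w : ℝ, r₀ ≤ w → w < 1 →
      ∃ f : ℂ → ℂ, MemHinf f ∧
        (∃ h : ℂ → ℂ, MemHinf h ∧ ∀ z ∈ ball (0 : ℂ) 1,
          g (mobius (w : ℂ) z) - f z * φ z =
            (∏ x ∈ Λ, blaschke (x : ℂ) z ^ k x) * h z) ∧
        (∀ ε : ℝ, 0 < ε → ∃ h' : ℂ → ℂ, MemHinf h' ∧ ∀ z ∈ ball (0 : ℂ) 1,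
          ‖f z - (∏ x ∈ Λ, blaschke (x : ℂ) z ^ k x) * h' z‖ ≤ C + ε) := by
  have hprod : ∀ z : ℂ, (∏ x ∈ Λ, blaschke (x : ℂ) z ^ k x) =
      (∏ x ∈ Λ, blaschke (x : ℂ) ^ k x) z := fun z => by simp [Finset.prod_apply]
  simp only [hprod]
  obtain ⟨-, -, hred⟩ := prod_blaschke_pow_induction
    (P := fun B => DifferentiableOn ℂ B (ball 0 1) ∧ (∀ z ∈ ball (0 : ℂ) 1, ‖B z‖ ≤ 1) ∧
      ReducesNullFamilies (𝓝[<] (1 : ℝ)) B) hΛ k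
    ⟨differentiableOn_const 1, fun _ _ => by simp, .one⟩
    (fun A B hA hB => ⟨hA.1.mul hB.1, fun z hz => by
      rw [Pi.mul_apply, norm_mul]
      exact mul_le_one₀ (hA.2.1 z hz) (norm_nonneg _) (hB.2.1 z hz),
      hA.2.2.mul hB.2.2 hA.1 hA.2.1⟩)
    (fun x hx => ⟨differentiableOn_mobius (hΛ x hx),
      fun z hz => (norm_mobius_lt_one (hΛ x hx) hz).le, .mobius (hΛ x hx)⟩)
  obtain ⟨u, v, hu, hv, huv⟩ := prod_blaschke_pow_induction (P := InvertibleModulo φ) hΛ k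
    .one (fun _ _ => .mul hφ) (fun x hx => .mobius hφ (hΛ x hx) (hφ0 x hx))
  generalize (∏ x ∈ Λ, blaschke (x : ℂ) ^ k x) = B at *
  obtain ⟨p, q, ⟨⟨N, hN⟩, -⟩, hpd, hp, e⟩ := hred _
    (isNullFamily_comp_mobius hg (by simpa using hgd 0))
  obtain ⟨M, hM⟩ := hu.2
  have hM0 : 0 < |M| + 1 := by positivity
  obtain ⟨a, ha, hsub⟩ := (mem_nhdsLT_iff_exists_Ioo_subset' (zero_lt_one' ℝ)).1
    (hN.and (hpd.and (hp (C / (|M| + 1)) (by positivity))))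
  have ha' : a < 1 := ha
  refine ⟨max (1 / 2) ((a + 1) / 2), ⟨lt_max_of_lt_left (by norm_num),
    max_lt (by norm_num) (by linarith)⟩, fun w hw hw1 => ?_⟩
  obtain ⟨⟨hqd, hqN⟩, hpd, hpC⟩ := hsub
    (show w ∈ Set.Ioo a 1 from ⟨by linarith [(le_max_right _ _).trans hw], hw1⟩)
  have hpH : MemHinf (p w) := memHinf_iff.2 ⟨hpd, _, hpC⟩
  refine ⟨fun z => u z * p w z, hu.mul hpH, ⟨fun z => q w z + p w z * v z,
    (memHinf_iff.2 ⟨hqd, N, hqN⟩).add (hpH.mul hv), fun z hz => ?_⟩,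
    fun ε hε => ⟨fun _ => 0, .const 0, fun z hz => ?_⟩⟩
  · have h1 := e w z hz
    have h2 := huv z hz
    linear_combination h1 - p w z * h2
  · rw [mul_zero, sub_zero, norm_mul]
    calc ‖u z‖ * ‖p w z‖ ≤ (|M| + 1) * (C / (|M| + 1)) :=
          mul_le_mul ((hM z hz).trans (by linarith [le_abs_self M])) (hpC z hz)
            (norm_nonneg _) hM0.le
      _ = C := mul_div_cancel₀ C hM0.ne'
      _ ≤ C + ε := by linarith
end
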